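/- arXiv:math/0603231 — 2 statements merged into one kernel-verified Lean document; each statement's English description precedes it below -/
import Mathlib

section
/- Assume n ≥ 3, r ≥ 2, and let G = G(r,r,n) and g = ξ_1^{ℓ} ξ_2^{−ℓ} with ℓ ≢ 0 (mod r) and 2ℓ ≢ 0 (mod r) (i.e., ℓ ≠ r/2). Set n' = n−2, f_{n'} = v_3⋯v_n, and f_i = e_i(v_3^r,…,v_n^r) for 1 ≤ i ≤ n'−1. Then the χ_g-semi-invariants form the free rank-one module S(V^g)^{χ_g} = ℂ[f_1,…,f_{n'−1}, f_{n'}^r] · f_{n'}^{r−1}. -/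
open MvPolynomial Matrix Finset

attribute [local instance] Classical.propDecidable

noncomputable section

/-- The group `G(r,p,n)` of monomial `n×n` matrices whose nonzero entries are `r`-th roots
of unity and such that the product of the nonzero entries raised to the `r/p` power is `1`.
(For a monomial matrix the product of the nonzero entries is `∏ i, ∑ j, M i j`.) -/
def GG (r p n : ℕ) : Set (Matrix (Fin n) (Fin n) ℂ) :=
  {M | (∃ (σ : Equiv.Perm (Fin n)) (d : Fin n → ℂ),
          (∀ j, d j ^ r = 1) ∧ ∀ i j, M i j = if i = σ j then d j else 0) ∧
       (∏ i, ∑ j, M i j) ^ (r / p) = 1}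

/-- The centralizer of `g` in `G(r,p,n)`. -/
def Zg (r p n : ℕ) (g : Matrix (Fin n) (Fin n) ℂ) : Set (Matrix (Fin n) (Fin n) ℂ) :=
  {h | h ∈ GG r p n ∧ h * g = g * h}

/-- The action of a matrix `M` on `S(V) = ℂ[v_1,…,v_n]`, sending the variable `X j`
(the `j`-th basis vector of `V`) to the linear form corresponding to `M · e_j`. -/
def act {n : ℕ} (M : Matrix (Fin n) (Fin n) ℂ) :
    MvPolynomial (Fin n) ℂ →ₐ[ℂ] MvPolynomial (Fin n) ℂ :=
  aeval fun j => ∑ i, C (M i j) * X i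

/-- `S(V^g)`: the subalgebra of `S(V)` generated by the linear forms corresponding to
vectors fixed by `g`. -/
def SVg {n : ℕ} (g : Matrix (Fin n) (Fin n) ℂ) : Subalgebra ℂ (MvPolynomial (Fin n) ℂ) :=
  Algebra.adjoin ℂ {q | ∃ c : Fin n → ℂ, g.mulVec c = c ∧ q = ∑ i, C (c i) * X i}

/-- The fixed space `V^g` inside Euclidean space `ℂⁿ`. -/
def fixedSpace {n : ℕ} (M : Matrix (Fin n) (Fin n) ℂ) :
    Submodule ℂ (EuclideanSpace ℂ (Fin n)) :=
  LinearMap.ker (Matrix.toEuclideanLin M - LinearMap.id)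

/-- The determinant of the restriction of an endomorphism to an invariant subspace
(junk value `0` if the subspace is not invariant). -/
def detOn {n : ℕ} (f : EuclideanSpace ℂ (Fin n) →ₗ[ℂ] EuclideanSpace ℂ (Fin n))
    (W : Submodule ℂ (EuclideanSpace ℂ (Fin n))) : ℂ :=
  if h : ∀ x ∈ W, f x ∈ W then LinearMap.det (f.restrict h) else 0

/-- The Hochschild character `χ_g(h) = det(h^⊥)`: the determinant of `h` restricted to the
orthogonal complement of the fixed space `V^g`. -/
def chi {n : ℕ} (g h : Matrix (Fin n) (Fin n) ℂ) : ℂ :=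
  detOn (Matrix.toEuclideanLin h) (fixedSpace g)ᗮ

/-- The diagonal element `g = ξ₁^ℓ ξ₂^{−ℓ}` of `G(r,r,n)`. -/
def gdiag (n : ℕ) [NeZero n] (ξ : ℂ) (ℓ : ℕ) : Matrix (Fin n) (Fin n) ℂ :=
  Matrix.diagonal fun t : Fin n => if t = 0 then ξ ^ ℓ else if t = 1 then (ξ ^ ℓ)⁻¹ else 1

/-- `f_i`: the `i`-th elementary symmetric polynomial in `v₃^r, …, v_n^r`. -/
def fmid (r n : ℕ) (i : ℕ) : MvPolynomial (Fin n) ℂ :=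
  ∑ s ∈ Finset.powersetCard i (Finset.univ.filter fun t : Fin n => 2 ≤ (t : ℕ)),
    ∏ t ∈ s, X t ^ r

/-- `f_{n'} = v₃ ⋯ v_n`. -/
def flast (n : ℕ) : MvPolynomial (Fin n) ℂ :=
  ∏ t ∈ Finset.univ.filter fun t : Fin n => 2 ≤ (t : ℕ), X t

lemma two_le_val_iff {n : ℕ} [NeZero n] (hn : 3 ≤ n) (t : Fin n) :
    2 ≤ (t : ℕ) ↔ t ≠ 0 ∧ t ≠ 1 := by
  have h1 : ((1 : Fin n) : ℕ) = 1 := by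
    rw [Fin.val_one', Nat.mod_eq_of_lt (by omega)]
  rw [Ne, Ne, Fin.ext_iff, Fin.ext_iff, h1, Fin.val_zero]
  omega

lemma zero_ne_one_of_three_le {n : ℕ} [NeZero n] (hn : 3 ≤ n) : (0 : Fin n) ≠ 1 := by
  have h1 : ((1 : Fin n) : ℕ) = 1 := by
    rw [Fin.val_one', Nat.mod_eq_of_lt (by omega)]
  rw [Ne, Fin.ext_iff, h1, Fin.val_zero]
  omega

/-- The monomial matrix sending `e_j` to `d j • e_{σ j}`. -/
def monoMat {n : ℕ} (σ : Equiv.Perm (Fin n)) (d : Fin n → ℂ) : Matrix (Fin n) (Fin n) ℂ :=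
  Matrix.of fun i j => if i = σ j then d j else 0

lemma monoMat_apply {n : ℕ} (σ : Equiv.Perm (Fin n)) (d : Fin n → ℂ) (i j : Fin n) :
    monoMat σ d i j = if i = σ j then d j else 0 := rfl

lemma monoMat_mulVec {n : ℕ} (σ : Equiv.Perm (Fin n)) (d x : Fin n → ℂ) (i : Fin n) :
    (monoMat σ d).mulVec x (σ i) = d i * x i := by
  simp [Matrix.mulVec, dotProduct, monoMat_apply]

lemma prod_sum_monoMat {n : ℕ} (σ : Equiv.Perm (Fin n)) (d : Fin n → ℂ) :
    ∏ i, ∑ j, monoMat σ d i j = ∏ j, d j := by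
  rw [← Equiv.prod_comp σ]
  simp [monoMat_apply]

lemma monoMat_mul_diagonal_eq_iff {n : ℕ} (σ : Equiv.Perm (Fin n)) (d c : Fin n → ℂ)
    (hd : ∀ j, d j ≠ 0) :
    monoMat σ d * Matrix.diagonal c = Matrix.diagonal c * monoMat σ d ↔
      ∀ j, c (σ j) = c j := by
  constructor
  · intro h j
    have := congrFun (congrFun h (σ j)) j
    rw [Matrix.mul_diagonal, Matrix.diagonal_mul, monoMat_apply, if_pos rfl, mul_comm] at this
    exact (mul_right_cancel₀ (hd j) this).symm
  · intro h
    ext i j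
    rw [Matrix.mul_diagonal, Matrix.diagonal_mul, monoMat_apply]
    split_ifs with hij
    · rw [hij, h, mul_comm]
    · simp

lemma gdiag_entry_comp_perm_iff {n : ℕ} [NeZero n] (hn : 3 ≤ n) {a : ℂ} (ha : a ≠ 1)
    (ha0 : a ≠ 0) (ha2 : a * a ≠ 1) (σ : Equiv.Perm (Fin n)) :
    (∀ j, (if σ j = 0 then a else if σ j = 1 then a⁻¹ else 1) =
      if j = 0 then a else if j = 1 then a⁻¹ else 1) ↔ σ 0 = 0 ∧ σ 1 = 1 := by
  have h01 := zero_ne_one_of_three_le hn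
  have hai : a⁻¹ ≠ 1 := by simpa using ha
  have haa : a⁻¹ ≠ a := fun h => ha2 (by nth_rewrite 1 [← h]; exact inv_mul_cancel₀ ha0)
  constructor
  · intro h
    constructor
    · have := h 0
      rw [if_pos rfl] at this
      split_ifs at this with h1 h2
      · exact h1
      · exact absurd this haa
      · exact absurd this.symm ha
    · have := h 1
      rw [if_neg h01.symm, if_pos rfl] at this
      split_ifs at this with h1 h2
      · exact absurd this.symm haa
      · exact h2
      · exact absurd this.symm hai
  · rintro ⟨h0, h1⟩ j
    have e0 : σ j = 0 ↔ j = 0 := by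
      nth_rewrite 1 [← h0]
      exact σ.apply_eq_iff_eq
    have e1 : σ j = 1 ↔ j = 1 := by
      nth_rewrite 1 [← h1]
      exact σ.apply_eq_iff_eq
    simp only [e0, e1]

lemma mem_Zg_gdiag_iff {r n : ℕ} [NeZero n] (hn : 3 ≤ n) (hr : 2 ≤ r)
    {ξ : ℂ} (hξ : IsPrimitiveRoot ξ r) {ℓ : ℕ} (h1 : ¬ r ∣ ℓ) (h2 : ¬ r ∣ 2 * ℓ)
    (h : Matrix (Fin n) (Fin n) ℂ) :
    h ∈ Zg r r n (gdiag n ξ ℓ) ↔ ∃ (σ : Equiv.Perm (Fin n)) (d : Fin n → ℂ),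
      h = monoMat σ d ∧ (∀ j, d j ^ r = 1) ∧ ∏ j, d j = 1 ∧ σ 0 = 0 ∧ σ 1 = 1 := by
  have hr0 : 0 < r := by omega
  have ha : ξ ^ ℓ ≠ 1 := fun h => h1 ((hξ.pow_eq_one_iff_dvd ℓ).1 h)
  have ha0 : ξ ^ ℓ ≠ 0 := pow_ne_zero _ (hξ.ne_zero (by omega))
  have ha2 : ξ ^ ℓ * ξ ^ ℓ ≠ 1 := fun h => h2 ((hξ.pow_eq_one_iff_dvd _).1 (by
    rw [two_mul, pow_add, h]))
  have key : ∀ (σ : Equiv.Perm (Fin n)) (d : Fin n → ℂ), (∀ j, d j ^ r = 1) →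
      (monoMat σ d * gdiag n ξ ℓ = gdiag n ξ ℓ * monoMat σ d ↔ σ 0 = 0 ∧ σ 1 = 1) := by
    intro σ d hd
    rw [← gdiag_entry_comp_perm_iff hn ha ha0 ha2]
    refine monoMat_mul_diagonal_eq_iff σ d _ fun j hj => ?_
    have := hd j
    rw [hj, zero_pow hr0.ne'] at this
    exact zero_ne_one this
  constructor
  · rintro ⟨⟨⟨σ, d, hd, hM⟩, hp⟩, hc⟩
    obtain rfl : h = monoMat σ d := by
      ext i j
      exact hM i j
    rw [Nat.div_self hr0, pow_one, prod_sum_monoMat] at hp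
    exact ⟨σ, d, rfl, hd, hp, (key σ d hd).1 hc⟩
  · rintro ⟨σ, d, rfl, hd, hp, hσ⟩
    refine ⟨⟨⟨σ, d, hd, fun _ _ => rfl⟩, ?_⟩, (key σ d hd).2 hσ⟩
    rw [Nat.div_self hr0, pow_one, prod_sum_monoMat, hp]

lemma gdiag_mulVec_eq_iff {n : ℕ} [NeZero n] (hn : 3 ≤ n) {ξ : ℂ} {ℓ : ℕ} (ha : ξ ^ ℓ ≠ 1)
    (c : Fin n → ℂ) : (gdiag n ξ ℓ).mulVec c = c ↔ c 0 = 0 ∧ c 1 = 0 := by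
  have h01 := zero_ne_one_of_three_le hn
  have hai : (ξ ^ ℓ)⁻¹ ≠ 1 := by simpa using ha
  rw [funext_iff]
  simp only [gdiag, Matrix.mulVec_diagonal]
  constructor
  · intro h
    constructor
    · have := h 0
      rw [if_pos rfl] at this
      by_contra hc
      exact ha (mul_right_cancel₀ hc (this.trans (one_mul _).symm))
    · have := h 1
      rw [if_neg h01.symm, if_pos rfl] at this
      by_contra hc
      exact hai (mul_right_cancel₀ hc (this.trans (one_mul _).symm))
  · rintro ⟨h0, h1⟩ x
    split_ifs with hx hx'
    · rw [hx, h0, mul_zero]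
    · rw [hx', h1, mul_zero]
    · rw [one_mul]

lemma SVg_gdiag {n : ℕ} [NeZero n] (hn : 3 ≤ n) {ξ : ℂ} {ℓ : ℕ} (ha : ξ ^ ℓ ≠ 1) :
    SVg (gdiag n ξ ℓ) = supported ℂ {t : Fin n | 2 ≤ (t : ℕ)} := by
  apply le_antisymm
  · refine Algebra.adjoin_le ?_
    rintro _ ⟨c, hc, rfl⟩
    rw [gdiag_mulVec_eq_iff hn ha] at hc
    refine Subalgebra.sum_mem _ fun i _ => ?_
    by_cases hi : 2 ≤ (i : ℕ)
    · exact Subalgebra.mul_mem _ (Subalgebra.algebraMap_mem _ (c i)) (X_mem_supported.2 hi)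
    · have : c i = 0 := by
        rw [two_le_val_iff hn, not_and_or, not_not, not_not] at hi
        rcases hi with rfl | rfl
        exacts [hc.1, hc.2]
      rw [this, C_0, zero_mul]
      exact Subalgebra.zero_mem _
  · rw [supported_eq_adjoin_X]
    refine Algebra.adjoin_le ?_
    rintro _ ⟨t, ht, rfl⟩
    refine Algebra.subset_adjoin ⟨Pi.single t 1, ?_, ?_⟩
    · rw [gdiag_mulVec_eq_iff hn ha]
      have ht' := (two_le_val_iff hn t).1 ht
      exact ⟨Pi.single_eq_of_ne ht'.1.symm _, Pi.single_eq_of_ne ht'.2.symm _⟩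
    · rw [Finset.sum_eq_single t]
      · simp
      · intro b _ hb
        simp [Pi.single_eq_of_ne hb]
      · simp

lemma mem_fixedSpace_gdiag_orthogonal_iff {n : ℕ} [NeZero n] (hn : 3 ≤ n) {ξ : ℂ} {ℓ : ℕ}
    (ha : ξ ^ ℓ ≠ 1) (x : EuclideanSpace ℂ (Fin n)) :
    x ∈ (fixedSpace (gdiag n ξ ℓ))ᗮ ↔ ∀ t : Fin n, 2 ≤ (t : ℕ) → x t = 0 := by
  have hfix : ∀ y : EuclideanSpace ℂ (Fin n),
      y ∈ fixedSpace (gdiag n ξ ℓ) ↔ y 0 = 0 ∧ y 1 = 0 := by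
    intro y
    rw [← gdiag_mulVec_eq_iff hn ha y.ofLp, fixedSpace, LinearMap.mem_ker, LinearMap.sub_apply,
      sub_eq_zero, LinearMap.id_apply, toLpLin_apply]
    exact ⟨fun h => congrArg WithLp.ofLp h, fun h => by rw [h]⟩
  rw [Submodule.mem_orthogonal]
  constructor
  · intro h t ht
    have := h (EuclideanSpace.single t 1) ((hfix _).2 (by
      have ht' := (two_le_val_iff hn t).1 ht
      simp [ht'.1.symm, ht'.2.symm]))
    simpa [EuclideanSpace.inner_single_left] using this
  · intro h y hy
    rw [hfix] at hy
    rw [PiLp.inner_apply]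
    refine Finset.sum_eq_zero fun t _ => ?_
    by_cases ht : 2 ≤ (t : ℕ)
    · rw [h t ht, inner_zero_right]
    · have : y t = 0 := by
        rw [two_le_val_iff hn, not_and_or, not_not, not_not] at ht
        rcases ht with rfl | rfl
        exacts [hy.1, hy.2]
      rw [this, inner_zero_left]

/-- A subspace of `ℂⁿ` consisting of the vectors supported on the first two coordinates is
isomorphic to `ℂ²`. -/
def firstTwoEquiv {n : ℕ} [NeZero n] (hn : 3 ≤ n) (W : Submodule ℂ (EuclideanSpace ℂ (Fin n)))
    (hW : ∀ x, x ∈ W ↔ ∀ t : Fin n, 2 ≤ (t : ℕ) → x t = 0) : W ≃ₗ[ℂ] (Fin 2 → ℂ) where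
  toFun x := ![x.1 0, x.1 1]
  map_add' x y := by ext i; fin_cases i <;> simp
  map_smul' c x := by ext i; fin_cases i <;> simp
  invFun v := ⟨WithLp.toLp 2 fun t => if t = 0 then v 0 else if t = 1 then v 1 else 0, by
    rw [hW]
    intro t ht
    have ht' := (two_le_val_iff hn t).1 ht
    simp [ht'.1, ht'.2]⟩
  left_inv x := by
    ext t
    have := (hW x.1).1 x.2 t
    rw [two_le_val_iff hn] at this
    by_cases h0 : t = 0
    · simp [h0]
    · by_cases h1 : t = 1
      · simp [h1, (zero_ne_one_of_three_le hn).symm]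
      · simp [h0, h1, this ⟨h0, h1⟩]
  right_inv v := by
    ext i
    fin_cases i <;> simp [(zero_ne_one_of_three_le hn).symm]

lemma chi_gdiag_monoMat {n : ℕ} [NeZero n] (hn : 3 ≤ n) {ξ : ℂ} {ℓ : ℕ} (ha : ξ ^ ℓ ≠ 1)
    (σ : Equiv.Perm (Fin n)) (d : Fin n → ℂ) (h0 : σ 0 = 0) (h1 : σ 1 = 1) :
    chi (gdiag n ξ ℓ) (monoMat σ d) = d 0 * d 1 := by
  have hW := mem_fixedSpace_gdiag_orthogonal_iff hn (n := n) ha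
  have hap : ∀ (x : EuclideanSpace ℂ (Fin n)) i,
      (Matrix.toEuclideanLin (monoMat σ d) x) (σ i) = d i * x i := by
    intro x i
    rw [toLpLin_apply]
    exact monoMat_mulVec σ d _ i
  have hinv : ∀ x ∈ (fixedSpace (gdiag n ξ ℓ))ᗮ,
      Matrix.toEuclideanLin (monoMat σ d) x ∈ (fixedSpace (gdiag n ξ ℓ))ᗮ := by
    intro x hx
    rw [hW] at hx ⊢
    intro t ht
    obtain ⟨i, rfl⟩ := σ.surjective t
    rw [hap, hx i, mul_zero]
    rw [two_le_val_iff hn] at ht ⊢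
    exact ⟨fun h => ht.1 (by rw [h, h0]), fun h => ht.2 (by rw [h, h1])⟩
  unfold chi detOn
  rw [dif_pos hinv, ← LinearMap.det_conj _ (firstTwoEquiv hn _ hW)]
  have : (firstTwoEquiv hn _ hW : _ →ₗ[ℂ] _) ∘ₗ
      (Matrix.toEuclideanLin (monoMat σ d)).restrict hinv ∘ₗ
      ((firstTwoEquiv hn _ hW).symm : _ →ₗ[ℂ] _) =
      Matrix.toLin' (Matrix.diagonal ![d 0, d 1]) := by
    refine LinearMap.ext fun v => ?_
    obtain ⟨x, rfl⟩ := (firstTwoEquiv hn _ hW).surjective v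
    have e0 := hap x.1 0
    have e1 := hap x.1 1
    rw [h0] at e0
    rw [h1] at e1
    ext i
    fin_cases i
    · rw [LinearMap.comp_apply, LinearMap.comp_apply, LinearEquiv.coe_coe, LinearEquiv.coe_coe,
        LinearEquiv.symm_apply_apply]
      simpa [firstTwoEquiv, Matrix.mulVec_diagonal] using e0
    · rw [LinearMap.comp_apply, LinearMap.comp_apply, LinearEquiv.coe_coe, LinearEquiv.coe_coe,
        LinearEquiv.symm_apply_apply]
      simpa [firstTwoEquiv, Matrix.mulVec_diagonal] using e1
  rw [this, LinearMap.det_toLin', Matrix.det_diagonal]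
  simp

section MonomialSubstitution

variable {τ : Type*}

/-- The substitution `X t ↦ e t * X (σ t)`. -/
def monoSubst (σ : Equiv.Perm τ) (e : τ → ℂ) : MvPolynomial τ ℂ →ₐ[ℂ] MvPolynomial τ ℂ :=
  aeval fun t => C (e t) * X (σ t)

lemma monoSubst_expand (σ : Equiv.Perm τ) (e : τ → ℂ) {r : ℕ} (he : ∀ t, e t ^ r = 1)
    (q : MvPolynomial τ ℂ) : monoSubst σ e (expand r q) = expand r (rename σ q) := by
  have : (monoSubst σ e).comp (expand r) = (expand r).comp (rename σ) := by
    ext1 t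
    simp [monoSubst, mul_pow, ← C_pow, he]
  exact DFunLike.congr_fun this q

variable [Fintype τ]

lemma coeff_monoSubst_one (e : τ → ℂ) (p : MvPolynomial τ ℂ) (m : τ →₀ ℕ) :
    coeff m (monoSubst 1 e p) = (∏ t, e t ^ m t) * coeff m p := by
  induction p using MvPolynomial.induction_on' with
  | monomial k c =>
    have : monoSubst 1 e (monomial k c) = C (∏ t, e t ^ k t) * monomial k c := by
      rw [monoSubst, aeval_monomial, Finsupp.prod_fintype _ _ (by simp)]
      simp only [mul_pow, Finset.prod_mul_distrib, Equiv.Perm.one_apply]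
      rw [monomial_eq (s := k), Finsupp.prod_fintype _ _ (by simp), algebraMap_eq, map_prod]
      simp only [C_pow]
      ring
    rw [this, coeff_C_mul, coeff_monomial]
    split_ifs with h
    · rw [h]
    · simp
  | add p q hp hq => rw [map_add, coeff_add, coeff_add, hp, hq, mul_add]

lemma monoSubst_prod_X (σ : Equiv.Perm τ) (e : τ → ℂ) :
    monoSubst σ e (∏ t, X t) = C (∏ t, e t) * ∏ t, X t := by
  rw [map_prod, map_prod]
  simp only [monoSubst, aeval_X, Finset.prod_mul_distrib]
  rw [Equiv.prod_comp σ (fun t => (X t : MvPolynomial τ ℂ))]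

lemma prod_X_ne_zero : (∏ t, X t : MvPolynomial τ ℂ) ≠ 0 :=
  Finset.prod_ne_zero_iff.2 fun t _ => X_ne_zero t

lemma exists_eq_prod_X_pow_mul_expand {r : ℕ} (hr : 0 < r) (f : MvPolynomial τ ℂ)
    (hf : ∀ m ∈ f.support, ∀ t, r ∣ m t + 1) :
    ∃ q, f = (∏ t, X t) ^ (r - 1) * expand r q := by
  refine ⟨∑ m ∈ f.support,
    monomial (m.mapRange (· / r) (Nat.zero_div r)) (coeff m f), ?_⟩
  conv_lhs => rw [f.as_sum]
  rw [map_sum, Finset.mul_sum]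
  refine Finset.sum_congr rfl fun m hm => ?_
  have hP : (∏ t, X t : MvPolynomial τ ℂ) ^ (r - 1) =
      monomial (Finsupp.equivFunOnFinite.symm fun _ => r - 1) 1 := by
    rw [monomial_eq, Finsupp.prod_fintype _ _ (by simp), C_1, one_mul, ← Finset.prod_pow]
    rfl
  rw [hP, expand_monomial, monomial_mul, one_mul]
  refine congrArg (fun k => monomial k (coeff m f)) (Finsupp.ext fun t => ?_)
  obtain ⟨k, hk⟩ := hf m hm t
  have hk0 : k ≠ 0 := by
    rintro rfl
    omega
  obtain ⟨k, rfl⟩ := Nat.exists_eq_succ_of_ne_zero hk0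
  have hm' : m t = r - 1 + r * k := by
    rw [Nat.succ_eq_add_one, mul_add] at hk
    omega
  have : m t / r = k := by
    rw [hm', Nat.add_mul_div_left _ _ hr, Nat.div_eq_of_lt (by omega), zero_add]
  change m t = (r - 1) + r * (m t / r)
  rw [this, hm']

lemma semiinvariant_monoSubst_iff {r : ℕ} (hr : 0 < r) {ξ : ℂ} (hξ : IsPrimitiveRoot ξ r)
    (f : MvPolynomial τ ℂ) :
    (∀ (σ : Equiv.Perm τ) (e : τ → ℂ), (∀ t, e t ^ r = 1) →
      monoSubst σ e f = (∏ t, e t)⁻¹ • f) ↔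
    ∃ q, q.IsSymmetric ∧ f = (∏ t, X t) ^ (r - 1) * expand r q := by
  constructor
  · intro h
    obtain ⟨q, hq⟩ := exists_eq_prod_X_pow_mul_expand hr f (by
      intro m hm t
      have h1 := h 1 (Pi.mulSingle t ξ) (by
        intro s
        rcases eq_or_ne s t with rfl | hs
        · rw [Pi.mulSingle_eq_same, hξ.pow_eq_one]
        · rw [Pi.mulSingle_eq_of_ne hs, one_pow])
      have h2 := congrArg (coeff m) h1
      have hprod : ∏ s, (Pi.mulSingle t ξ : τ → ℂ) s ^ m s = ξ ^ m t := by
        rw [Finset.prod_eq_single t]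
        · rw [Pi.mulSingle_eq_same]
        · intro s _ hs
          rw [Pi.mulSingle_eq_of_ne hs, one_pow]
        · simp
      have hprod' : ∏ s, (Pi.mulSingle t ξ : τ → ℂ) s = ξ := by
        rw [Finset.prod_eq_single t]
        · rw [Pi.mulSingle_eq_same]
        · intro s _ hs
          rw [Pi.mulSingle_eq_of_ne hs]
        · simp
      rw [coeff_monoSubst_one, coeff_smul, smul_eq_mul, hprod, hprod'] at h2
      have h3 := mul_right_cancel₀ (mem_support_iff.1 hm) h2
      rw [← hξ.pow_eq_one_iff_dvd, pow_succ, h3, inv_mul_cancel₀ (hξ.ne_zero hr.ne')])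
    refine ⟨q, fun σ => ?_, hq⟩
    have h1 := h σ (fun _ => 1) (by simp)
    have h2 := monoSubst_prod_X σ (fun _ : τ => (1 : ℂ))
    rw [Finset.prod_const_one, inv_one, one_smul, hq, map_mul, map_pow, h2,
      monoSubst_expand _ _ (by simp), Finset.prod_const_one, C_1, one_mul] at h1
    exact expand_injective hr (mul_left_cancel₀ (pow_ne_zero _ prod_X_ne_zero) h1)
  · rintro ⟨q, hq, rfl⟩ σ e he
    rw [map_mul, map_pow, monoSubst_prod_X, monoSubst_expand _ _ he, hq σ, mul_pow, ← C_pow,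
      smul_eq_C_mul, mul_assoc]
    congr 2
    refine eq_inv_of_mul_eq_one_left ?_
    rw [← pow_succ, Nat.sub_add_cancel hr, ← Finset.prod_pow]
    exact Finset.prod_eq_one fun t _ => he t

lemma symmetricSubalgebra_eq_adjoin_esymm :
    symmetricSubalgebra τ ℂ =
      Algebra.adjoin ℂ (esymm τ ℂ '' Set.Icc 1 (Fintype.card τ)) := by
  apply le_antisymm
  · intro p hp
    obtain ⟨q, hq⟩ := esymmAlgHom_surjective (σ := τ) ℂ le_rfl ⟨p, hp⟩
    have := esymmAlgHom_apply (σ := τ) (R := ℂ) (n := Fintype.card τ) q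
    rw [hq] at this
    change p = _ at this
    rw [this]
    refine Algebra.adjoin_mono ?_ (aeval_range (R := ℂ) (fun i : Fin (Fintype.card τ) =>
      esymm τ ℂ (i + 1)) ▸ AlgHom.mem_range_self _ q)
    rintro _ ⟨i, rfl⟩
    exact ⟨i + 1, ⟨by omega, by omega⟩, rfl⟩
  · refine Algebra.adjoin_le ?_
    rintro _ ⟨i, _, rfl⟩
    exact esymm_isSymmetric τ ℂ i

end MonomialSubstitution

/-- The polynomials in `v_i ^ r`, `i ≥ 3`, inside `S(V)`. -/
def expandTail (r n : ℕ) :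
    MvPolynomial {t : Fin n // 2 ≤ (t : ℕ)} ℂ →ₐ[ℂ] MvPolynomial (Fin n) ℂ :=
  (rename Subtype.val).comp (expand r)

lemma prod_filter_two_le {n : ℕ} {M : Type*} [CommMonoid M] (u : Fin n → M) :
    ∏ t ∈ Finset.univ.filter (fun t : Fin n => 2 ≤ (t : ℕ)), u t =
      ∏ t : {t : Fin n // 2 ≤ (t : ℕ)}, u t :=
  Finset.prod_subtype _ (by simp) _

lemma prod_eq_mul_prod_two_le {n : ℕ} [NeZero n] (hn : 3 ≤ n) {M : Type*} [CommMonoid M]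
    (u : Fin n → M) :
    ∏ t, u t = u 0 * u 1 * ∏ t : {t : Fin n // 2 ≤ (t : ℕ)}, u t := by
  rw [← prod_filter_two_le, ← Finset.prod_filter_not_mul_prod_filter Finset.univ
    (fun t : Fin n => 2 ≤ (t : ℕ)) u]
  congr 1
  have : Finset.univ.filter (fun t : Fin n => ¬ 2 ≤ (t : ℕ)) = {0, 1} := by
    ext t
    simp only [Finset.mem_filter, Finset.mem_univ, true_and, two_le_val_iff hn, not_and_or,
      not_not, Finset.mem_insert, Finset.mem_singleton]
  rw [this, Finset.prod_pair (zero_ne_one_of_three_le hn)]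

lemma flast_eq_rename (n : ℕ) :
    flast n = rename Subtype.val (∏ t : {t : Fin n // 2 ≤ (t : ℕ)}, X t) := by
  rw [flast, prod_filter_two_le, map_prod]
  simp

lemma fmid_eq_expandTail (r n i : ℕ) :
    fmid r n i = expandTail r n (esymm {t : Fin n // 2 ≤ (t : ℕ)} ℂ i) := by
  have h1 : expandTail r n = aeval fun t => (X t.1 ^ r : MvPolynomial (Fin n) ℂ) := by
    ext1 t
    simp [expandTail]
  have h2 : (Finset.univ.filter fun t : Fin n => 2 ≤ (t : ℕ)) =
      Finset.univ.map (Function.Embedding.subtype fun t : Fin n => 2 ≤ (t : ℕ)) := by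
    ext t
    simp
  rw [h1, aeval_esymm_eq_multiset_esymm, fmid, ← Finset.esymm_map_val, h2, Finset.map_val,
    Multiset.map_map]
  rfl

lemma card_two_le_subtype (n : ℕ) : Fintype.card {t : Fin n // 2 ≤ (t : ℕ)} = n - 2 := by
  have e : {t : Fin n // 2 ≤ (t : ℕ)} ≃ Fin (n - 2) :=
    { toFun := fun t => ⟨t.1 - 2, by omega⟩
      invFun := fun s => ⟨⟨s + 2, by omega⟩, by simp⟩
      left_inv := fun t => Subtype.ext (Fin.ext (Nat.sub_add_cancel t.2))
      right_inv := fun s => Fin.ext (Nat.add_sub_cancel _ _) }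
  rw [Fintype.card_congr e, Fintype.card_fin]

lemma adjoin_eq_map_symmetricSubalgebra (r n : ℕ) (hn : 3 ≤ n) :
    Algebra.adjoin ℂ (insert (flast n ^ r) ((fun i => fmid r n i) '' Set.Ico 1 (n - 2))) =
      (symmetricSubalgebra {t : Fin n // 2 ≤ (t : ℕ)} ℂ).map (expandTail r n) := by
  have htop : flast n ^ r = fmid r n (n - 2) := by
    have hc : #(Finset.univ.filter fun t : Fin n => 2 ≤ (t : ℕ)) = n - 2 := by
      rw [← card_two_le_subtype n, Fintype.card_subtype]
    rw [fmid, ← hc, Finset.powersetCard_self, Finset.sum_singleton, flast, Finset.prod_pow]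
  have hIcc : Set.Icc 1 (n - 2) = insert (n - 2) (Set.Ico 1 (n - 2)) := by
    ext i
    simp only [Set.mem_Icc, Set.mem_insert_iff, Set.mem_Ico]
    omega
  rw [symmetricSubalgebra_eq_adjoin_esymm, AlgHom.map_adjoin, card_two_le_subtype, hIcc,
    Set.image_image, Set.image_insert_eq, htop]
  simp only [fmid_eq_expandTail]

lemma act_monoMat_rename {n : ℕ} (σ : Equiv.Perm (Fin n)) (d : Fin n → ℂ)
    (σ' : Equiv.Perm {t : Fin n // 2 ≤ (t : ℕ)}) (hσ : ∀ t, σ t.1 = σ' t)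
    (p : MvPolynomial {t : Fin n // 2 ≤ (t : ℕ)} ℂ) :
    act (monoMat σ d) (rename Subtype.val p) =
      rename Subtype.val (monoSubst σ' (fun t => d t) p) := by
  have : (act (monoMat σ d)).comp (rename Subtype.val) =
      (rename Subtype.val).comp (monoSubst σ' fun t => d t) := by
    ext1 t
    simp only [AlgHom.comp_apply, rename_X, act, monoSubst, aeval_X, map_mul, algHom_C,
      algebraMap_eq, monoMat_apply]
    rw [Finset.sum_eq_single (σ t.1) (by intro b _ hb; simp [hb]) (by simp), if_pos rfl, hσ]
  exact DFunLike.congr_fun this p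

lemma semiinvariant_rename_iff {r n : ℕ} [NeZero n] (hn : 3 ≤ n) (hr : 2 ≤ r)
    {ξ : ℂ} (hξ : IsPrimitiveRoot ξ r) {ℓ : ℕ} (h1 : ¬ r ∣ ℓ) (h2 : ¬ r ∣ 2 * ℓ)
    (p : MvPolynomial {t : Fin n // 2 ≤ (t : ℕ)} ℂ) :
    (∀ h ∈ Zg r r n (gdiag n ξ ℓ),
      act h (rename Subtype.val p) = chi (gdiag n ξ ℓ) h • rename Subtype.val p) ↔
    ∀ (σ : Equiv.Perm {t : Fin n // 2 ≤ (t : ℕ)}) (e : {t : Fin n // 2 ≤ (t : ℕ)} → ℂ),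
      (∀ t, e t ^ r = 1) → monoSubst σ e p = (∏ t, e t)⁻¹ • p := by
  have ha : ξ ^ ℓ ≠ 1 := fun h => h1 ((hξ.pow_eq_one_iff_dvd ℓ).1 h)
  have h01 := zero_ne_one_of_three_le hn
  have hinj := rename_injective (R := ℂ)
    (Subtype.val : {t : Fin n // 2 ≤ (t : ℕ)} → Fin n) Subtype.val_injective
  have hchi : ∀ (σ : Equiv.Perm (Fin n)) (d : Fin n → ℂ), ∏ j, d j = 1 → σ 0 = 0 → σ 1 = 1 →
      chi (gdiag n ξ ℓ) (monoMat σ d) = (∏ t : {t : Fin n // 2 ≤ (t : ℕ)}, d t)⁻¹ := by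
    intro σ d hd h0 h1
    rw [chi_gdiag_monoMat hn ha σ d h0 h1]
    rw [prod_eq_mul_prod_two_le hn] at hd
    exact eq_inv_of_mul_eq_one_left hd
  constructor
  · intro H σ e he
    let d : Fin n → ℂ := fun t =>
      if ht : 2 ≤ (t : ℕ) then e ⟨t, ht⟩ else if t = 0 then (∏ t, e t)⁻¹ else 1
    have hd : ∀ t : {t : Fin n // 2 ≤ (t : ℕ)}, d t = e t := fun t => dif_pos t.2
    have h0 : ¬ 2 ≤ ((0 : Fin n) : ℕ) := by simp
    have h1 : ¬ 2 ≤ ((1 : Fin n) : ℕ) := fun h => ((two_le_val_iff hn _).1 h).2 rfl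
    have hd0 : d 0 = (∏ t, e t)⁻¹ := by simp only [d, dif_neg h0, if_true]
    have hd1 : d 1 = 1 := by simp only [d, dif_neg h1, if_neg h01.symm]
    have he0 : (∏ t, e t) ^ r = 1 := by
      rw [← Finset.prod_pow]
      exact Finset.prod_eq_one fun t _ => he t
    have hne : ∏ t, e t ≠ 0 := fun h => by
      rw [h, zero_pow (by omega)] at he0
      exact zero_ne_one he0
    have hp : ∏ t, d t = 1 := by
      rw [prod_eq_mul_prod_two_le hn, hd0, hd1, mul_one]
      simp only [hd]
      exact inv_mul_cancel₀ hne
    have hs0 := Equiv.Perm.ofSubtype_apply_of_not_mem σ h0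
    have hs1 := Equiv.Perm.ofSubtype_apply_of_not_mem σ h1
    have := H (monoMat (Equiv.Perm.ofSubtype σ) d) ((mem_Zg_gdiag_iff hn hr hξ ‹_› h2 _).2
      ⟨_, d, rfl, fun j => by
        by_cases hj : 2 ≤ (j : ℕ)
        · rw [hd ⟨j, hj⟩, he]
        · simp only [d, dif_neg hj]
          split_ifs
          · rw [inv_pow, he0, inv_one]
          · rw [one_pow], hp, hs0, hs1⟩)
    rw [hchi _ _ hp hs0 hs1,
      act_monoMat_rename _ _ σ (fun t => Equiv.Perm.ofSubtype_apply_coe σ t), ← map_smul] at this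
    simp only [hd] at this
    exact hinj this
  · intro H h hh
    obtain ⟨σ, d, rfl, hd, hp, h0, h1⟩ := (mem_Zg_gdiag_iff hn hr hξ h1 h2 h).1 hh
    have e0 : ∀ j, σ j = 0 ↔ j = 0 := fun j => by
      nth_rewrite 1 [← h0]
      exact σ.apply_eq_iff_eq
    have e1 : ∀ j, σ j = 1 ↔ j = 1 := fun j => by
      nth_rewrite 1 [← h1]
      exact σ.apply_eq_iff_eq
    have hσ : ∀ t : Fin n, 2 ≤ (σ t : ℕ) ↔ 2 ≤ (t : ℕ) := fun t => by
      rw [two_le_val_iff hn, two_le_val_iff hn, Ne, Ne, e0, e1]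
    rw [hchi σ d hp h0 h1, act_monoMat_rename σ d (σ.subtypePerm hσ) (fun t => rfl),
      H _ _ fun t => hd t, map_smul]

/-- Assume `n ≥ 3`, `r ≥ 2`, and let `G = G(r,r,n)` and
`g = ξ₁^ℓ ξ₂^{−ℓ}` with `ℓ ≢ 0 (mod r)` and `2ℓ ≢ 0 (mod r)`.  With `n' = n−2`,
`f_{n'} = v₃⋯v_n` and `f_i = e_i(v₃^r,…,v_n^r)` for `1 ≤ i ≤ n'−1`, the
`χ_g`-semi-invariants form the free rank-one module
`S(V^g)^{χ_g} = ℂ[f₁,…,f_{n'−1}, f_{n'}^r] · f_{n'}^{r−1}`. -/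
theorem semiinvariants_of_diagonal_in_Grrn
    (r n : ℕ) [NeZero n] (hn : 3 ≤ n) (hr : 2 ≤ r)
    (ξ : ℂ) (hξ : IsPrimitiveRoot ξ r)
    (ℓ : ℕ) (h1 : ¬ r ∣ ℓ) (h2 : ¬ r ∣ 2 * ℓ)
    (R : Subalgebra ℂ (MvPolynomial (Fin n) ℂ))
    (hR : R = Algebra.adjoin ℂ
        (insert (flast n ^ r) ((fun i => fmid r n i) '' Set.Ico 1 (n - 2)))) :
    ({f : MvPolynomial (Fin n) ℂ |
        f ∈ SVg (gdiag n ξ ℓ) ∧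
          ∀ h ∈ Zg r r n (gdiag n ξ ℓ), act h f = chi (gdiag n ξ ℓ) h • f}
      = {f | ∃ a ∈ R, f = a * flast n ^ (r - 1)})
    ∧ ∀ a ∈ R, a * flast n ^ (r - 1) = 0 → a = 0 := by
  have ha : ξ ^ ℓ ≠ 1 := fun h => h1 ((hξ.pow_eq_one_iff_dvd ℓ).1 h)
  have hr0 : 0 < r := by omega
  rw [adjoin_eq_map_symmetricSubalgebra r n hn] at hR
  subst hR
  refine ⟨?_, fun a _ h => (mul_eq_zero.1 h).resolve_right (pow_ne_zero _ ?_)⟩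
  · ext f
    simp only [Set.mem_ofPred_eq, SVg_gdiag hn ha, flast_eq_rename]
    constructor
    · rintro ⟨hf, H⟩
      rw [supported_eq_range_rename] at hf
      obtain ⟨p, rfl⟩ := hf
      obtain ⟨q, hq, hpq⟩ := (semiinvariant_monoSubst_iff hr0 hξ p).1
        ((semiinvariant_rename_iff hn hr hξ h1 h2 p).1 H)
      refine ⟨expandTail r n q, ⟨q, hq, rfl⟩, ?_⟩
      rw [hpq, mul_comm]
      exact (map_mul _ _ _).trans (congrArg _ (map_pow _ _ _))
    · rintro ⟨_, ⟨q, hq, rfl⟩, rfl⟩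
      have : expandTail r n q * (rename Subtype.val
          (∏ t : {t : Fin n // 2 ≤ (t : ℕ)}, X t : MvPolynomial _ ℂ)) ^ (r - 1) =
          rename Subtype.val ((∏ t, X t) ^ (r - 1) * expand r q) := by
        rw [map_mul, map_pow, mul_comm]
        rfl
      change expandTail r n q * _ ∈ _ ∧ ∀ h ∈ _, act h (expandTail r n q * _) =
        _ • (expandTail r n q * _)
      rw [this]
      constructor
      · rw [supported_eq_range_rename]
        exact ⟨_, rfl⟩
      · exact (semiinvariant_rename_iff hn hr hξ h1 h2 _).2
          ((semiinvariant_monoSubst_iff hr0 hξ _).2 ⟨q, hq, rfl⟩)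
  · exact Finset.prod_ne_zero_iff.2 fun t _ => X_ne_zero t

end
end

section
/- Let G = WB_n = G(2,1,n) (the group of n×n monomial matrices with nonzero entries ±1) act on V = ℂ^n, with n ≥ 4, and let g = (1,−2) be the element sending v_2 ↦ v_1, v_1 ↦ −v_2 and fixing v_3,…,v_n (i.e., g = ξ_2(1,2) with ξ = −1). Then the χ_g-semi-invariants are S(V^g)^{χ_g} = ℂ[f'_1, …, f'_{n−2}], where f'_i = e_i(v_3^2, …, v_n^2) is the i-th elementary symmetric polynomial in v_3^2,…,v_n^2. -/
open MvPolynomial Matrix Finset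

attribute [local instance] Classical.propDecidable

noncomputable section

/-- The element `(1,−2)` of `WB_n = G(2,1,n)`, sending `v₂ ↦ v₁`, `v₁ ↦ −v₂`
and fixing `v₃,…,v_n`. -/
def gOneMinusTwo (n : ℕ) [NeZero n] : Matrix (Fin n) (Fin n) ℂ :=
  Matrix.of fun i j : Fin n =>
    if i = Equiv.swap (0 : Fin n) 1 j then (if j = 0 then (-1 : ℂ) else 1) else 0

/-- The indices of the coordinates fixed by `gOneMinusTwo (m + 2)`. -/
abbrev Rest (m : ℕ) := {t : Fin (m + 2) // 2 ≤ (t : ℕ)}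

/-- The monomial matrix sending `e_j` to `d_j e_{σ j}`. -/
def monomialMatrix {n : ℕ} (σ : Equiv.Perm (Fin n)) (d : Fin n → ℂ) :
    Matrix (Fin n) (Fin n) ℂ :=
  Matrix.of fun i j => if i = σ j then d j else 0

lemma monomialMatrix_apply_of_eq {n : ℕ} {σ : Equiv.Perm (Fin n)} {d : Fin n → ℂ}
    {i j : Fin n} (h : i = σ j) : monomialMatrix σ d i j = d j :=
  if_pos h

lemma monomialMatrix_apply_of_ne {n : ℕ} {σ : Equiv.Perm (Fin n)} {d : Fin n → ℂ}
    {i j : Fin n} (h : i ≠ σ j) : monomialMatrix σ d i j = 0 :=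
  if_neg h

lemma mul_monomialMatrix_apply {n : ℕ} (M : Matrix (Fin n) (Fin n) ℂ)
    (σ : Equiv.Perm (Fin n)) (d : Fin n → ℂ) (i j : Fin n) :
    (M * monomialMatrix σ d) i j = M i (σ j) * d j := by
  simp [monomialMatrix, Matrix.mul_apply]

lemma monomialMatrix_mul_apply {n : ℕ} (M : Matrix (Fin n) (Fin n) ℂ)
    (σ : Equiv.Perm (Fin n)) (d : Fin n → ℂ) (i j : Fin n) :
    (monomialMatrix σ d * M) (σ i) j = d i * M i j := by
  simp [monomialMatrix, Matrix.mul_apply]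

lemma monomialMatrix_mul {n : ℕ} (σ τ : Equiv.Perm (Fin n)) (d e : Fin n → ℂ) :
    monomialMatrix σ d * monomialMatrix τ e =
      monomialMatrix (σ * τ) fun j => d (τ j) * e j := by
  ext i j
  rw [mul_monomialMatrix_apply]
  by_cases h : i = σ (τ j)
  · rw [monomialMatrix_apply_of_eq h, monomialMatrix_apply_of_eq (σ := σ * τ) h]
  · rw [monomialMatrix_apply_of_ne h, monomialMatrix_apply_of_ne (σ := σ * τ) h, zero_mul]

lemma monomialMatrix_mem_GG {n : ℕ} {σ : Equiv.Perm (Fin n)} {d : Fin n → ℂ}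
    (hd : ∀ j, d j ^ 2 = 1) : monomialMatrix σ d ∈ GG 2 1 n := by
  refine ⟨⟨σ, d, hd, fun i j => by simp [monomialMatrix]⟩, ?_⟩
  have h (i : Fin n) : ∑ j, monomialMatrix σ d i j = d (σ.symm i) := by
    simp [monomialMatrix, ← Equiv.symm_apply_eq]
  simp [h, ← Finset.prod_pow, hd]

lemma act_monomialMatrix_X {n : ℕ} (σ : Equiv.Perm (Fin n)) (d : Fin n → ℂ) (j : Fin n) :
    act (monomialMatrix σ d) (X j) = C (d j) * X (σ j) := by
  simp [act, monomialMatrix, apply_ite C, ite_mul]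

lemma gOneMinusTwo_eq (m : ℕ) : gOneMinusTwo (m + 2) =
    monomialMatrix (Equiv.swap 0 1) fun j => if j = 0 then -1 else 1 := rfl

lemma not_two_le_iff {m : ℕ} {t : Fin (m + 2)} : ¬ 2 ≤ (t : ℕ) ↔ t = 0 ∨ t = 1 := by
  simp only [Fin.ext_iff, Fin.val_zero, Fin.val_one]
  omega

lemma swap_zero_one_eq_self {m : ℕ} {t : Fin (m + 2)} :
    Equiv.swap (0 : Fin (m + 2)) 1 t = t ↔ 2 ≤ (t : ℕ) := by
  rw [← not_iff_not, not_two_le_iff, ← ne_eq, Equiv.swap_apply_ne_self_iff]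
  simp

/-- Elements of the centralizer are monomial matrices whose permutation preserves
the first two indices. -/
lemma exists_of_mem_Zg {m : ℕ} {h : Matrix (Fin (m + 2)) (Fin (m + 2)) ℂ}
    (hh : h ∈ Zg 2 1 (m + 2) (gOneMinusTwo (m + 2))) :
    ∃ σ d, h = monomialMatrix σ d ∧ (∀ j, d j ^ 2 = 1) ∧
      ∀ t, 2 ≤ (σ t : ℕ) ↔ 2 ≤ (t : ℕ) := by
  obtain ⟨⟨⟨σ, d, hd, hM⟩, -⟩, hcomm⟩ := hh
  have hM : h = monomialMatrix σ d := by ext i j; simp [hM, monomialMatrix]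
  refine ⟨σ, d, hM, hd, fun t => ?_⟩
  have hd0 (j) : d j ≠ 0 := fun h0 => by simpa [h0] using hd j
  have key : σ (Equiv.swap 0 1 t) = Equiv.swap 0 1 (σ t) := by
    rw [hM, gOneMinusTwo_eq, monomialMatrix_mul, monomialMatrix_mul] at hcomm
    have h := congrFun (congrFun hcomm (σ (Equiv.swap 0 1 t))) t
    by_contra hne
    have : (if t = 0 then (-1 : ℂ) else 1) ≠ 0 := by split_ifs <;> simp
    rw [monomialMatrix_apply_of_eq (by rfl), monomialMatrix_apply_of_ne (by exact hne)] at h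
    exact mul_ne_zero (hd0 _) this h
  rw [← swap_zero_one_eq_self, ← key, σ.injective.eq_iff, swap_zero_one_eq_self]

lemma gOneMinusTwo_mulVec_eq_self {m : ℕ} {c : Fin (m + 2) → ℂ} :
    gOneMinusTwo (m + 2) *ᵥ c = c ↔ c 0 = 0 ∧ c 1 = 0 := by
  have h (i) : (gOneMinusTwo (m + 2) *ᵥ c) i =
      (if i = 1 then -1 else 1) * c (Equiv.swap 0 1 i) := by
    simp only [gOneMinusTwo, mulVec, dotProduct, of_apply]
    rw [Finset.sum_eq_single (Equiv.swap 0 1 i)]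
    · by_cases hi : i = 1 <;> simp [hi, Equiv.swap_apply_eq_iff]
    · intro j _ hj
      rw [if_neg, zero_mul]
      rintro rfl
      simp at hj
    · simp
  rw [funext_iff]
  simp only [h]
  constructor
  · intro H
    have h0 := H 0
    have h1 := H 1
    simp at h0 h1
    rw [← h0, neg_eq_iff_add_eq_zero, ← two_mul] at h1
    simp at h1
    simp [← h0, h1]
  · rintro ⟨h0, h1⟩ i
    rcases eq_or_ne i 0 with rfl | hi
    · simp [h0, h1]
    rcases eq_or_ne i 1 with rfl | hi'
    · simp [h0, h1]
    rw [Equiv.swap_apply_of_ne_of_ne hi hi']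
    simp [hi']

lemma mem_fixedSpace_gOneMinusTwo {m : ℕ} {x : EuclideanSpace ℂ (Fin (m + 2))} :
    x ∈ fixedSpace (gOneMinusTwo (m + 2)) ↔ x 0 = 0 ∧ x 1 = 0 := by
  rw [fixedSpace, LinearMap.mem_ker, LinearMap.sub_apply, sub_eq_zero,
    ← gOneMinusTwo_mulVec_eq_self, ← (WithLp.ofLp_injective 2).eq_iff]
  rfl

lemma mem_fixedSpace_gOneMinusTwo_orthogonal {m : ℕ} {x : EuclideanSpace ℂ (Fin (m + 2))} :
    x ∈ (fixedSpace (gOneMinusTwo (m + 2)))ᗮ ↔ ∀ t : Rest m, x t = 0 := by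
  rw [Submodule.mem_orthogonal]
  constructor
  · rintro h ⟨t, ht⟩
    have h0 : (0 : Fin (m + 2)) ≠ t := by rintro rfl; simp at ht
    have h1 : (1 : Fin (m + 2)) ≠ t := by rintro rfl; simp at ht
    simpa [EuclideanSpace.inner_single_left] using h (EuclideanSpace.single t 1)
      (mem_fixedSpace_gOneMinusTwo.2 ⟨by simp [h0], by simp [h1]⟩)
  · intro h u hu
    rw [mem_fixedSpace_gOneMinusTwo] at hu
    rw [PiLp.inner_apply]
    refine Finset.sum_eq_zero fun i _ => ?_
    by_cases hi : 2 ≤ (i : ℕ)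
    · simp [h ⟨i, hi⟩]
    · have := not_two_le_iff.1 hi
      rcases this with rfl | rfl <;> simp [hu]

/-- The orthogonal complement of the fixed space is spanned by the first two coordinates. -/
def orthogonalEquiv (m : ℕ) :
    (fixedSpace (gOneMinusTwo (m + 2)))ᗮ ≃ₗ[ℂ] (Fin 2 → ℂ) where
  toFun x := ![x.1 0, x.1 1]
  invFun c := ⟨WithLp.toLp 2 (vecCons (c 0) (vecCons (c 1) 0)),
    mem_fixedSpace_gOneMinusTwo_orthogonal.2 fun ⟨t, ht⟩ => by
      obtain ⟨k, hk⟩ := Nat.exists_eq_add_of_le' ht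
      have : t = Fin.succ (Fin.succ ⟨k, by omega⟩) := Fin.ext hk
      simp [this]⟩
  map_add' x y := by ext i; fin_cases i <;> simp
  map_smul' c x := by ext i; fin_cases i <;> simp
  left_inv x := by
    ext i
    induction i using Fin.cases with
    | zero => simp
    | succ i =>
      induction i using Fin.cases with
      | zero => simp
      | succ i => simpa using
          (mem_fixedSpace_gOneMinusTwo_orthogonal.1 x.2 ⟨i.succ.succ, by simp⟩).symm
  right_inv c := by ext i; fin_cases i <;> simp

/-- The Hochschild character of `gOneMinusTwo` is trivial. -/
lemma chi_eq_one {m : ℕ} {h : Matrix (Fin (m + 2)) (Fin (m + 2)) ℂ}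
    (hh : h ∈ Zg 2 1 (m + 2) (gOneMinusTwo (m + 2))) :
    chi (gOneMinusTwo (m + 2)) h = 1 := by
  obtain ⟨σ, d, hM, hd, hσ⟩ := exists_of_mem_Zg hh
  have hentry (i j) : h i j = if i = σ j then d j else 0 := by simp [hM, monomialMatrix]
  have hcomm := hh.2
  have hinv : ∀ x ∈ (fixedSpace (gOneMinusTwo (m + 2)))ᗮ,
      toEuclideanLin h x ∈ (fixedSpace (gOneMinusTwo (m + 2)))ᗮ := by
    intro x hx
    rw [mem_fixedSpace_gOneMinusTwo_orthogonal] at hx ⊢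
    intro t
    change ∑ j, h t j * x j = 0
    refine Finset.sum_eq_zero fun j _ => ?_
    by_cases hj : 2 ≤ (j : ℕ)
    · simp [hx ⟨j, hj⟩]
    · rw [← hσ] at hj
      have : (t : Fin (m + 2)) ≠ σ j := fun h => hj (h ▸ t.2)
      simp [hentry, this]
  rw [chi, detOn, dif_pos hinv, ← LinearMap.det_conj _ (orthogonalEquiv m)]
  have hmat : (orthogonalEquiv m).toLinearMap ∘ₗ LinearMap.restrict (toEuclideanLin h) hinv ∘ₗ
      (orthogonalEquiv m).symm.toLinearMap =
      toLin' !![h 0 0, h 0 1; h 1 0, h 1 1] := by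
    refine LinearMap.ext fun c => funext fun i => ?_
    fin_cases i <;>
      simp [orthogonalEquiv, toLpLin_apply, mulVec, dotProduct, Fin.sum_univ_succ]
  rw [hmat, LinearMap.det_toLin', det_fin_two_of]
  rw [gOneMinusTwo_eq] at hcomm
  have e1 : h 0 0 = h 1 1 := by
    have := congrFun (congrFun hcomm (Equiv.swap 0 1 1)) 1
    rw [mul_monomialMatrix_apply, monomialMatrix_mul_apply] at this
    simpa using this
  have e2 : h 0 1 = - h 1 0 := by
    have := congrFun (congrFun hcomm (Equiv.swap 0 1 1)) 0
    rw [mul_monomialMatrix_apply, monomialMatrix_mul_apply] at this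
    simp at this
    linear_combination -this
  have h0 : σ 0 = 0 ∨ σ 0 = 1 := by
    rw [← not_two_le_iff, hσ]
    simp
  rw [← e1, e2]
  rcases h0 with h0 | h0 <;> simp [hentry, h0] <;> linear_combination hd 0

lemma exists_rename_of_mem_SVg {m : ℕ} {f : MvPolynomial (Fin (m + 2)) ℂ}
    (hf : f ∈ SVg (gOneMinusTwo (m + 2))) :
    ∃ p : MvPolynomial (Rest m) ℂ, rename Subtype.val p = f := by
  suffices h : SVg (gOneMinusTwo (m + 2)) ≤
      (rename (R := ℂ) (Subtype.val : Rest m → Fin (m + 2))).range from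
    h hf
  refine Algebra.adjoin_le ?_
  rintro _ ⟨c, hc, rfl⟩
  rw [gOneMinusTwo_mulVec_eq_self] at hc
  refine Subalgebra.sum_mem _ fun i _ => ?_
  by_cases hi : 2 ≤ (i : ℕ)
  · exact ⟨C (c i) * X (⟨i, hi⟩ : Rest m), by simp⟩
  · have := not_two_le_iff.1 hi
    rcases this with rfl | rfl <;> simp [hc]

lemma rename_mem_SVg {m : ℕ} (p : MvPolynomial (Rest m) ℂ) :
    rename Subtype.val p ∈ SVg (gOneMinusTwo (m + 2)) := by
  induction p using MvPolynomial.induction_on with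
  | C a => rw [rename_C]; exact Subalgebra.algebraMap_mem _ a
  | add p q hp hq => rw [map_add]; exact Subalgebra.add_mem _ hp hq
  | mul_X p i hp =>
    rw [map_mul, rename_X]
    refine Subalgebra.mul_mem _ hp (Algebra.subset_adjoin ⟨Pi.single i.1 1, ?_, ?_⟩)
    · have := i.2
      rw [gOneMinusTwo_mulVec_eq_self]
      constructor <;> rw [Pi.single_eq_of_ne] <;> intro h <;> simp [← h] at this
    · simp [Pi.single_apply, apply_ite C, ite_mul]

/-- The signed permutation of all coordinates extending one of the fixed coordinates. -/
def extend {m : ℕ} (τ : Equiv.Perm (Rest m)) (d : Rest m → ℂ) :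
    Matrix (Fin (m + 2)) (Fin (m + 2)) ℂ :=
  monomialMatrix (Equiv.Perm.ofSubtype τ) fun j => if h : 2 ≤ (j : ℕ) then d ⟨j, h⟩ else 1

lemma extend_mem_Zg {m : ℕ} (τ : Equiv.Perm (Rest m)) (d : Rest m → ℂ)
    (hd : ∀ j, d j ^ 2 = 1) :
    extend τ d ∈ Zg 2 1 (m + 2) (gOneMinusTwo (m + 2)) := by
  refine ⟨monomialMatrix_mem_GG fun j => ?_, ?_⟩
  · split_ifs <;> simp [hd]
  · have hlow {j : Fin (m + 2)} (hj : ¬ 2 ≤ (j : ℕ)) : Equiv.Perm.ofSubtype τ j = j :=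
      Equiv.Perm.ofSubtype_apply_of_not_mem τ hj
    have h0 : ¬ 2 ≤ ((0 : Fin (m + 2)) : ℕ) := by simp
    have h1 : ¬ 2 ≤ ((1 : Fin (m + 2)) : ℕ) := by simp
    rw [extend, gOneMinusTwo_eq, monomialMatrix_mul, monomialMatrix_mul]
    congr 1
    · rw [Equiv.mul_swap_eq_swap_mul, hlow h0, hlow h1]
    · ext j
      by_cases hj : 2 ≤ (j : ℕ)
      · have hj0 : j ≠ 0 := by rintro rfl; exact h0 hj
        have : Equiv.Perm.ofSubtype τ j ≠ 0 := by
          rw [← hlow h0, (Equiv.injective _).ne_iff]; exact hj0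
        simp [swap_zero_one_eq_self.2 hj, this, hj0]
      · rw [hlow hj]
        have : ¬ 2 ≤ ((Equiv.swap 0 1 j : Fin (m + 2)) : ℕ) := by
          rw [← swap_zero_one_eq_self, (Equiv.injective _).eq_iff, swap_zero_one_eq_self]
          exact hj
        rw [dif_neg hj, dif_neg this, mul_comm]

lemma act_extend_rename {m : ℕ} (τ : Equiv.Perm (Rest m)) (d : Rest m → ℂ)
    (p : MvPolynomial (Rest m) ℂ) :
    act (extend τ d) (rename Subtype.val p) =
      rename Subtype.val (aeval (fun j => C (d j) * X (τ j)) p) := by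
  rw [← AlgHom.comp_apply, ← AlgHom.comp_apply]
  congr 1
  ext1 j
  simp [extend, act_monomialMatrix_X, j.2]

lemma coeff_aeval_C_mul_X {ι R : Type*} [Fintype ι] [CommSemiring R] (d : ι → R)
    (p : MvPolynomial ι R) (s : ι →₀ ℕ) :
    coeff s (aeval (fun j => C (d j) * X j : ι → MvPolynomial ι R) p) =
      (∏ j, d j ^ s j) * coeff s p := by
  induction p using MvPolynomial.induction_on' with
  | add p q hp hq => rw [map_add, coeff_add, hp, hq, coeff_add, mul_add]
  | monomial u a =>
    have : aeval (fun j => C (d j) * X j : ι → MvPolynomial ι R) (monomial u a) =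
        monomial u ((∏ j, d j ^ u j) * a) := by
      rw [aeval_monomial, Finsupp.prod_fintype _ _ (by simp), monomial_eq,
        Finsupp.prod_fintype _ _ (by simp)]
      simp only [mul_pow, Finset.prod_mul_distrib, map_mul, map_prod, map_pow, algebraMap_eq]
      ring
    rw [this, coeff_monomial, coeff_monomial]
    split_ifs with h
    · rw [h]
    · rw [mul_zero]

/-- A polynomial invariant under all sign changes is a polynomial in the squares. -/
lemma exists_expand_two_of_sign_invariant {ι : Type*} [Fintype ι] {p : MvPolynomial ι ℂ}
    (hp : ∀ d : ι → ℂ, (∀ j, d j ^ 2 = 1) →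
      aeval (fun j => C (d j) * X j : ι → MvPolynomial ι ℂ) p = p) :
    ∃ q, expand 2 q = p := by
  rw [← AlgHom.mem_range, p.as_sum]
  refine Subalgebra.sum_mem _ fun s hs => ?_
  have heven (i : ι) : Even (s i) := by
    by_contra hodd
    rw [Nat.not_even_iff_odd] at hodd
    have h := congrArg (coeff s) (hp (Function.update 1 i (-1)) fun j => by
      rcases eq_or_ne j i with rfl | hj <;> simp [*])
    rw [coeff_aeval_C_mul_X, Finset.prod_eq_single i
      (fun j _ hj => by simp [hj]) (by simp), Function.update_self, hodd.neg_one_pow,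
      neg_one_mul, neg_eq_self] at h
    exact mem_support_iff.1 hs h
  refine ⟨monomial (s.mapRange (· / 2) (by simp)) (coeff s p), ?_⟩
  change expand 2 _ = _
  have hs : 2 • s.mapRange (· / 2) (by simp) = s := Finsupp.ext fun i => by
    simpa using Nat.mul_div_cancel' (heven i).two_dvd
  rw [expand_monomial, hs]

lemma rename_expand_esymm {m : ℕ} (i : ℕ) :
    rename Subtype.val (expand 2 (esymm (Rest m) ℂ i)) =
      ∑ s ∈ Finset.powersetCard i (Finset.univ.filter fun t : Fin (m + 2) => 2 ≤ (t : ℕ)),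
        ∏ t ∈ s, (X t : MvPolynomial (Fin (m + 2)) ℂ) ^ 2 := by
  have hu : (Finset.univ.filter fun t : Fin (m + 2) => 2 ≤ (t : ℕ)) =
      (Finset.univ : Finset (Rest m)).map (Function.Embedding.subtype _) := by
    ext t; simp
  rw [hu, Finset.powersetCard_map, Finset.sum_map]
  simp [esymm, Finset.prod_map]

lemma card_rest (m : ℕ) : Fintype.card (Rest m) = m := by
  rw [Fintype.card_subtype]
  simp [Fin.card_filter_univ_succ]

lemma expandRest_mem_adjoin {m : ℕ} {q : MvPolynomial (Rest m) ℂ} (hq : q.IsSymmetric) :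
    rename Subtype.val (expand 2 q) ∈ Algebra.adjoin ℂ
      ((fun i => ∑ s ∈ Finset.powersetCard i
          (Finset.univ.filter fun t : Fin (m + 2) => 2 ≤ (t : ℕ)),
        ∏ t ∈ s, (X t : MvPolynomial (Fin (m + 2)) ℂ) ^ 2) '' Set.Icc 1 (m + 2 - 2)) := by
  obtain ⟨r, hr⟩ := esymmAlgHom_surjective (σ := Rest m) (R := ℂ)
    (card_rest m).le ⟨q, hq⟩
  obtain rfl : aeval (fun i : Fin m => esymm (Rest m) ℂ (i + 1)) r = q := by
    rw [← esymmAlgHom_apply, hr]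
  clear hr hq
  induction r using MvPolynomial.induction_on with
  | C a =>
    simp only [aeval_C, algebraMap_eq, expand_C, rename_C]
    exact Subalgebra.algebraMap_mem _ a
  | add p q hp hq => simp only [map_add]; exact Subalgebra.add_mem _ hp hq
  | mul_X p i hp =>
    simp only [map_mul, aeval_X]
    refine Subalgebra.mul_mem _ hp (Algebra.subset_adjoin ⟨i + 1, ?_, ?_⟩)
    · simp
    · exact (rename_expand_esymm _).symm

lemma mem_range_of_mem_adjoin {m : ℕ} {f : MvPolynomial (Fin (m + 2)) ℂ}
    (hf : f ∈ Algebra.adjoin ℂ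
      ((fun i => ∑ s ∈ Finset.powersetCard i
          (Finset.univ.filter fun t : Fin (m + 2) => 2 ≤ (t : ℕ)),
        ∏ t ∈ s, (X t : MvPolynomial (Fin (m + 2)) ℂ) ^ 2) '' Set.Icc 1 (m + 2 - 2))) :
    ∃ q : MvPolynomial (Rest m) ℂ, q.IsSymmetric ∧ rename Subtype.val (expand 2 q) = f := by
  change f ∈ (symmetricSubalgebra (Rest m) ℂ).map
    ((rename (R := ℂ) (Subtype.val : Rest m → Fin (m + 2))).comp (expand 2))
  refine Algebra.adjoin_le ?_ hf
  rintro _ ⟨i, -, rfl⟩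
  exact ⟨esymm (Rest m) ℂ i, esymm_isSymmetric _ _ _, rename_expand_esymm i⟩

lemma act_expandRest {m : ℕ} {q : MvPolynomial (Rest m) ℂ} (hq : q.IsSymmetric)
    {h : Matrix (Fin (m + 2)) (Fin (m + 2)) ℂ}
    (hh : h ∈ Zg 2 1 (m + 2) (gOneMinusTwo (m + 2))) :
    act h (rename Subtype.val (expand 2 q)) = rename Subtype.val (expand 2 q) := by
  obtain ⟨σ, d, rfl, hd, hσ⟩ := exists_of_mem_Zg hh
  conv_rhs => rw [← hq (σ.subtypePerm hσ)]
  simp only [← AlgHom.comp_apply]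
  congr 1
  ext1 j
  simp [act_monomialMatrix_X, mul_pow, ← C_pow, hd]

/-- Let `G = WB_n = G(2,1,n)` act on `V = ℂⁿ` with `n ≥ 4`, and let
`g = (1,−2)`.  Then the `χ_g`-semi-invariants are
`S(V^g)^{χ_g} = ℂ[f'₁, …, f'_{n−2}]`, where `f'_i = e_i(v₃², …, v_n²)`. -/
theorem semiinvariants_of_one_minus_two_in_WBn
    (n : ℕ) [NeZero n] (hn : 4 ≤ n) :
    {f : MvPolynomial (Fin n) ℂ |
        f ∈ SVg (gOneMinusTwo n) ∧
          ∀ h ∈ Zg 2 1 n (gOneMinusTwo n), act h f = chi (gOneMinusTwo n) h • f}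
      = ↑(Algebra.adjoin ℂ
          ((fun i => ∑ s ∈ Finset.powersetCard i
                (Finset.univ.filter fun t : Fin n => 2 ≤ (t : ℕ)),
              ∏ t ∈ s, (X t : MvPolynomial (Fin n) ℂ) ^ 2) '' Set.Icc 1 (n - 2))) := by
  obtain ⟨m, rfl⟩ : ∃ m, n = m + 2 := ⟨n - 2, by omega⟩
  ext f
  constructor
  · rintro ⟨hf, hinv⟩
    obtain ⟨p, rfl⟩ := exists_rename_of_mem_SVg hf
    have hp (τ : Equiv.Perm (Rest m)) (d : Rest m → ℂ) (hd : ∀ j, d j ^ 2 = 1) :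
        aeval (fun j => C (d j) * X (τ j)) p = p := by
      apply rename_injective _ Subtype.val_injective
      have h := hinv _ (extend_mem_Zg τ d hd)
      rw [chi_eq_one (extend_mem_Zg τ d hd), one_smul, act_extend_rename] at h
      exact h
    obtain ⟨q, rfl⟩ := exists_expand_two_of_sign_invariant fun d hd => hp 1 d hd
    have hq : q.IsSymmetric := fun τ => by
      apply expand_injective two_pos
      rw [← rename_expand]
      have h := hp τ 1 (by simp)
      simp only [Pi.one_apply, map_one, one_mul] at h
      rwa [rename_eq_aeval]
    exact expandRest_mem_adjoin hq
  · intro hf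
    have hmem := mem_range_of_mem_adjoin hf
    obtain ⟨p, hp, rfl⟩ := hmem
    exact ⟨rename_mem_SVg _, fun h hh => by
      rw [chi_eq_one hh, one_smul, act_expandRest hp hh]⟩

end
end
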